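/- Let V be an infinite-dimensional vector space over a field K and let L(V) denote the lattice of all subspaces of V. Then the tensor product M₄ ⊗ L(V) is not a lattice; in particular, there exists a quadruple (x₀, x₁, x₂, x₃) ∈ L(V)⁴ whose adjustment sequence never stabilizes: (x₀, x₁, x₂, x₃)^{(n)} ≠ (x₀, x₁, x₂, x₃)^{(n+1)} for every n. -/

import Mathlib

section TensorDefs

variable {α β : Type*} [Lattice α] [OrderBot α] [Lattice β] [OrderBot β]

/-- `∇ = (A × {0}) ∪ ({0} × B)`. -/
def nablaSet (α β : Type*) [Lattice α] [OrderBot α] [Lattice β] [OrderBot β] :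
    Set (α × β) :=
  {p | p.1 = ⊥ ∨ p.2 = ⊥}

/-- A *bi-ideal* of `A × B`: a down-set containing `∇` and closed under joins in each
coordinate separately. -/
def IsBiIdeal (I : Set (α × β)) : Prop :=
  IsLowerSet I ∧ nablaSet α β ⊆ I ∧
  (∀ a₀ a₁ b, (a₀, b) ∈ I → (a₁, b) ∈ I → (a₀ ⊔ a₁, b) ∈ I) ∧
  (∀ a b₀ b₁, (a, b₀) ∈ I → (a, b₁) ∈ I → (a, b₀ ⊔ b₁) ∈ I)

/-- Membership in the tensor product `A ⊗ B`: the bi-ideals that are finite joins of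
pure tensors `a ⊗ b`, i.e. the smallest bi-ideal containing some finite subset of `A × B`. -/
def InTensor (I : Set (α × β)) : Prop :=
  ∃ s : Finset (α × β), I = ⋂₀ {J : Set (α × β) | IsBiIdeal J ∧ ↑s ⊆ J}

end TensorDefs

/-- The tensor product `A ⊗ B`, as a partially ordered set (ordered by inclusion). -/
abbrev TensorProd (α β : Type*) [Lattice α] [OrderBot α] [Lattice β] [OrderBot β] :=
  {I : Set (α × β) // InTensor I}

/-- `M` is the lattice `M₄`: the six distinct elements `⊥, a, b, c, d, ⊤`, where
`a, b, c, d` are four atoms with pairwise meets `⊥` and pairwise joins `⊤`. -/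
def IsM4 (M : Type*) [Lattice M] [BoundedOrder M] (a b c d : M) : Prop :=
  (∀ x : M, x = ⊥ ∨ x = a ∨ x = b ∨ x = c ∨ x = d ∨ x = ⊤) ∧
  a ≠ b ∧ a ≠ c ∧ a ≠ d ∧ b ≠ c ∧ b ≠ d ∧ c ≠ d ∧
  a ≠ ⊥ ∧ b ≠ ⊥ ∧ c ≠ ⊥ ∧ d ≠ ⊥ ∧ a ≠ ⊤ ∧ b ≠ ⊤ ∧ c ≠ ⊤ ∧ d ≠ ⊤ ∧ (⊥ : M) ≠ ⊤ ∧
  a ⊓ b = ⊥ ∧ a ⊓ c = ⊥ ∧ a ⊓ d = ⊥ ∧ b ⊓ c = ⊥ ∧ b ⊓ d = ⊥ ∧ c ⊓ d = ⊥ ∧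
  a ⊔ b = ⊤ ∧ a ⊔ c = ⊤ ∧ a ⊔ d = ⊤ ∧ b ⊔ c = ⊤ ∧ b ⊔ d = ⊤ ∧ c ⊔ d = ⊤

/-- One step of the adjustment sequence for quadruples:
`q_{i,n+1} = q_{i,n} ⊔ (q_{j,n} ⊓ q_{k,n}) ⊔ (q_{j,n} ⊓ q_{l,n}) ⊔ (q_{k,n} ⊓ q_{l,n})`. -/
def adj4 {α : Type*} [Lattice α] : α × α × α × α → α × α × α × α
  | (a, b, c, d) =>
    (a ⊔ b ⊓ c ⊔ b ⊓ d ⊔ c ⊓ d,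
     b ⊔ a ⊓ c ⊔ a ⊓ d ⊔ c ⊓ d,
     c ⊔ a ⊓ b ⊔ a ⊓ d ⊔ b ⊓ d,
     d ⊔ a ⊓ b ⊔ a ⊓ c ⊔ b ⊓ c)

section BiIdeals

variable {α β : Type*} [Lattice α] [OrderBot α] [Lattice β] [OrderBot β]

/-- The least bi-ideal containing a given set. -/
def biIdealClosure (s : Set (α × β)) : Set (α × β) :=
  ⋂₀ {J : Set (α × β) | IsBiIdeal J ∧ s ⊆ J}

theorem subset_biIdealClosure (s : Set (α × β)) : s ⊆ biIdealClosure s :=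
  Set.subset_sInter fun _ hJ => hJ.2

theorem biIdealClosure_subset {s J : Set (α × β)} (hJ : IsBiIdeal J) (hs : s ⊆ J) :
    biIdealClosure s ⊆ J :=
  Set.sInter_subset_of_mem ⟨hJ, hs⟩

theorem isBiIdeal_biIdealClosure (s : Set (α × β)) : IsBiIdeal (biIdealClosure s) := by
  refine ⟨?_, ?_, ?_, ?_⟩
  · intro p q hqp hp J hJ
    exact hJ.1.1 hqp (hp J hJ)
  · intro p hp J hJ
    exact hJ.1.2.1 hp
  · intro a₀ a₁ b h₀ h₁ J hJ
    exact hJ.1.2.2.1 _ _ _ (h₀ J hJ) (h₁ J hJ)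
  · intro a b₀ b₁ h₀ h₁ J hJ
    exact hJ.1.2.2.2 _ _ _ (h₀ J hJ) (h₁ J hJ)

/-- The pure tensor `a ⊗ b` as a set of pairs. -/
def pureTensor (a : α) (b : β) : Set (α × β) :=
  {p | p.1 = ⊥ ∨ p.2 = ⊥ ∨ p.1 ≤ a ∧ p.2 ≤ b}

theorem isBiIdeal_pureTensor (a : α) (b : β) : IsBiIdeal (pureTensor a b) := by
  refine ⟨?_, ?_, ?_, ?_⟩
  · rintro ⟨m, x⟩ ⟨m', x'⟩ ⟨hm : m' ≤ m, hx : x' ≤ x⟩ (rfl | rfl | ⟨h₁, h₂⟩)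
    · exact Or.inl (le_bot_iff.1 hm)
    · exact Or.inr (Or.inl (le_bot_iff.1 hx))
    · exact Or.inr (Or.inr ⟨hm.trans h₁, hx.trans h₂⟩)
  · rintro p (h | h)
    · exact Or.inl h
    · exact Or.inr (Or.inl h)
  · rintro a₀ a₁ x h₀ h₁
    simp only [pureTensor, Set.mem_ofPred_eq] at h₀ h₁ ⊢
    rcases h₀ with rfl | h₀ | h₀
    · simpa using h₁
    · exact Or.inr (Or.inl h₀)
    · rcases h₁ with rfl | h₁ | h₁
      · simp [h₀]
      · exact Or.inr (Or.inl h₁)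
      · exact Or.inr (Or.inr ⟨sup_le h₀.1 h₁.1, h₀.2⟩)
  · rintro m x₀ x₁ h₀ h₁
    simp only [pureTensor, Set.mem_ofPred_eq] at h₀ h₁ ⊢
    rcases h₀ with h₀ | rfl | h₀
    · exact Or.inl h₀
    · simpa using h₁
    · rcases h₁ with h₁ | rfl | h₁
      · exact Or.inl h₁
      · simp [h₀]
      · exact Or.inr (Or.inr ⟨h₀.1, sup_le h₀.2 h₁.2⟩)

/-- The element of the tensor product generated by a finite set of pairs. -/
def TensorProd.gen (s : Finset (α × β)) : TensorProd α β :=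
  ⟨biIdealClosure ↑s, s, rfl⟩

/-- A greatest lower bound in the tensor product contains every common element. -/
theorem TensorProd.mem_of_isGLB {I J C : TensorProd α β} (hC : IsGLB {I, J} C)
    {p : α × β} (hI : p ∈ I.1) (hJ : p ∈ J.1) : p ∈ C.1 := by
  have key : ∀ H : TensorProd α β, p ∈ H.1 → TensorProd.gen {p} ≤ H := by
    rintro ⟨_, s, rfl⟩ hp
    exact biIdealClosure_subset (isBiIdeal_biIdealClosure _) (by simpa using hp)
  have h : TensorProd.gen {p} ≤ C := by
    apply hC.2
    rintro H (rfl | rfl)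
    · exact key _ hI
    · exact key _ hJ
  exact h (subset_biIdealClosure _ (by simp))

end BiIdeals

section Adjustment

variable {α β : Type*} [Lattice α] [Lattice β]

theorem le_adj4 (t : α × α × α × α) : t ≤ adj4 t := by
  obtain ⟨x, y, z, w⟩ := t
  refine ⟨?_, ?_, ?_, ?_⟩ <;>
    exact le_sup_of_le_left (le_sup_of_le_left le_sup_left)

theorem monotone_iterate_adj4 (t : α × α × α × α) : Monotone fun n => adj4^[n] t := by
  refine monotone_nat_of_le_succ fun n => ?_
  rw [Function.iterate_succ_apply']
  exact le_adj4 _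

/-- Apply a map to all entries of a quadruple. -/
def mapQuad (f : α → β) (t : α × α × α × α) : β × β × β × β :=
  (f t.1, f t.2.1, f t.2.2.1, f t.2.2.2)

theorem adj4_mapQuad {f : α → β} (hsup : ∀ x y, f (x ⊔ y) = f x ⊔ f y)
    (hinf : ∀ x y, f (x ⊓ y) = f x ⊓ f y) (t : α × α × α × α) :
    adj4 (mapQuad f t) = mapQuad f (adj4 t) := by
  simp [mapQuad, adj4, hsup, hinf]

theorem iterate_adj4_ne_of_unbounded {t : α × α × α × α}
    (ht : ∀ n, ∃ k, ¬ (adj4^[k] t).1 ≤ (adj4^[n] t).1) (n : ℕ) :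
    adj4^[n] t ≠ adj4^[n + 1] t := by
  intro h
  obtain ⟨k, hk⟩ := ht n
  apply hk
  rcases le_total k n with hkn | hkn
  · exact (monotone_iterate_adj4 t hkn).1
  · obtain ⟨j, rfl⟩ := Nat.exists_eq_add_of_le hkn
    have hfix : adj4^[j] (adj4^[n] t) = adj4^[n] t := by
      refine Function.iterate_fixed ?_ j
      rw [← Function.iterate_succ_apply' adj4 n t]
      exact h.symm
    rw [add_comm, Function.iterate_add_apply, hfix]

end Adjustment

section MFour

variable {M : Type*} [Lattice M] [BoundedOrder M] {a b c d : M}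

theorem IsM4.swap_left (h : IsM4 M a b c d) : IsM4 M b a c d := by
  unfold IsM4 at *
  obtain ⟨h0, h⟩ := h
  refine ⟨fun x => ?_, ?_⟩
  · have := h0 x
    tauto
  · have := inf_comm a b
    have := sup_comm a b
    grind

theorem IsM4.rotate (h : IsM4 M a b c d) : IsM4 M b c d a := by
  unfold IsM4 at *
  obtain ⟨h0, h⟩ := h
  refine ⟨fun x => ?_, ?_⟩
  · have := h0 x
    tauto
  · have := inf_comm a
    have := sup_comm a
    grind

theorem IsM4.eq_of_le (h : IsM4 M a b c d) {m : M} (hm : m ≤ a) (h0 : m ≠ ⊥) : m = a := by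
  obtain ⟨hall, hne⟩ := h
  rcases hall m with hm' | hm' | hm' | hm' | hm' | hm'
  · exact absurd hm' h0
  · exact hm'
  all_goals
    have := inf_eq_left.2 hm
    have := inf_comm m a
    grind

theorem IsM4.le_sup_cases (h : IsM4 M a b c d) {x y : M} (hxy : a ≤ x ⊔ y) :
    a ≤ x ∨ a ≤ y ∨ (b ≤ x ∧ c ≤ y) ∨ (c ≤ x ∧ b ≤ y) ∨ (b ≤ x ∧ d ≤ y) ∨
      (d ≤ x ∧ b ≤ y) ∨ (c ≤ x ∧ d ≤ y) ∨ (d ≤ x ∧ c ≤ y) := by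
  have hab : ¬ a ≤ b := fun hl => h.2.1 (h.swap_left.eq_of_le hl (by unfold IsM4 at h; tauto))
  have hac : ¬ a ≤ c := fun hl => by
    have := inf_eq_left.2 hl
    unfold IsM4 at h
    grind
  have had : ¬ a ≤ d := fun hl => by
    have := inf_eq_left.2 hl
    unfold IsM4 at h
    grind
  rcases h.1 x with rfl | rfl | rfl | rfl | rfl | rfl <;>
  rcases h.1 y with rfl | rfl | rfl | rfl | rfl | rfl <;>
  simp_all

variable {β : Type*} [Lattice β]

theorem IsM4.le_adj4_fst (h : IsM4 M a b c d) {m₀ m₁ : M} {u x y z w : β}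
    (ha : a ≤ m₀ ∨ a ≤ m₁ → u ≤ x) (hb : b ≤ m₀ ∨ b ≤ m₁ → u ≤ y)
    (hc : c ≤ m₀ ∨ c ≤ m₁ → u ≤ z) (hd : d ≤ m₀ ∨ d ≤ m₁ → u ≤ w) (hm : a ≤ m₀ ⊔ m₁) :
    u ≤ x ⊔ y ⊓ z ⊔ y ⊓ w ⊔ z ⊓ w := by
  have hyz : y ⊓ z ≤ x ⊔ y ⊓ z ⊔ y ⊓ w ⊔ z ⊓ w :=
    le_sup_of_le_left (le_sup_of_le_left le_sup_right)
  have hyw : y ⊓ w ≤ x ⊔ y ⊓ z ⊔ y ⊓ w ⊔ z ⊓ w := le_sup_of_le_left le_sup_right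
  have hzw : z ⊓ w ≤ x ⊔ y ⊓ z ⊔ y ⊓ w ⊔ z ⊓ w := le_sup_right
  have hx : x ≤ x ⊔ y ⊓ z ⊔ y ⊓ w ⊔ z ⊓ w :=
    le_sup_of_le_left (le_sup_of_le_left le_sup_left)
  rcases h.le_sup_cases hm with h | h | ⟨h, h'⟩ | ⟨h, h'⟩ | ⟨h, h'⟩ | ⟨h, h'⟩ | ⟨h, h'⟩ | ⟨h, h'⟩
  · exact (ha (Or.inl h)).trans hx
  · exact (ha (Or.inr h)).trans hx
  · exact (le_inf (hb (Or.inl h)) (hc (Or.inr h'))).trans hyz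
  · exact (le_inf (hb (Or.inr h')) (hc (Or.inl h))).trans hyz
  · exact (le_inf (hb (Or.inl h)) (hd (Or.inr h'))).trans hyw
  · exact (le_inf (hb (Or.inr h')) (hd (Or.inl h))).trans hyw
  · exact (le_inf (hc (Or.inl h)) (hd (Or.inr h'))).trans hzw
  · exact (le_inf (hc (Or.inr h')) (hd (Or.inl h))).trans hzw

variable [OrderBot β]

theorem IsM4.adj4_mem (h : IsM4 M a b c d) {I : Set (M × β)} (hI : IsBiIdeal I)
    {t : β × β × β × β} (ha : (a, t.1) ∈ I) (hb : (b, t.2.1) ∈ I) (hc : (c, t.2.2.1) ∈ I)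
    (hd : (d, t.2.2.2) ∈ I) :
    (a, (adj4 t).1) ∈ I ∧ (b, (adj4 t).2.1) ∈ I ∧ (c, (adj4 t).2.2.1) ∈ I ∧
      (d, (adj4 t).2.2.2) ∈ I := by
  obtain ⟨x, y, z, w⟩ := t
  obtain ⟨hlow, -, hl, hr⟩ := hI
  have key : ∀ {m p q : M} {u v : β}, (p, u) ∈ I → (q, v) ∈ I → p ⊔ q = ⊤ →
      (m, u ⊓ v) ∈ I := by
    intro m p q u v hp hq hpq
    have h₁ : (p, u ⊓ v) ∈ I := hlow (Prod.mk_le_mk.2 ⟨le_rfl, inf_le_left⟩) hp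
    have h₂ : (q, u ⊓ v) ∈ I := hlow (Prod.mk_le_mk.2 ⟨le_rfl, inf_le_right⟩) hq
    have := hl _ _ _ h₁ h₂
    rw [hpq] at this
    exact hlow (Prod.mk_le_mk.2 ⟨le_top, le_rfl⟩) this
  obtain ⟨-, -, -, -, -, -, -, -, -, -, -, -, -, -, -, -, -, -, -, -, -, -, ab, ac, ad, bc, bd,
    cd⟩ := h
  refine ⟨?_, ?_, ?_, ?_⟩
  · exact hr _ _ _ (hr _ _ _ (hr _ _ _ ha (key hb hc bc)) (key hb hd bd)) (key hc hd cd)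
  · exact hr _ _ _ (hr _ _ _ (hr _ _ _ hb (key ha hc ac)) (key ha hd ad)) (key hc hd cd)
  · exact hr _ _ _ (hr _ _ _ (hr _ _ _ hc (key ha hb ab)) (key ha hd ad)) (key hb hd bd)
  · exact hr _ _ _ (hr _ _ _ (hr _ _ _ hd (key ha hb ab)) (key ha hc ac)) (key hb hc bc)

theorem IsM4.iterate_adj4_mem (h : IsM4 M a b c d) {I : Set (M × β)} (hI : IsBiIdeal I)
    {t : β × β × β × β} (ha : (a, t.1) ∈ I) (hb : (b, t.2.1) ∈ I) (hc : (c, t.2.2.1) ∈ I)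
    (hd : (d, t.2.2.2) ∈ I) (n : ℕ) :
    (a, (adj4^[n] t).1) ∈ I ∧ (b, (adj4^[n] t).2.1) ∈ I ∧ (c, (adj4^[n] t).2.2.1) ∈ I ∧
      (d, (adj4^[n] t).2.2.2) ∈ I := by
  induction n with
  | zero => exact ⟨ha, hb, hc, hd⟩
  | succ n ih =>
    rw [Function.iterate_succ_apply']
    exact h.adj4_mem hI ih.1 ih.2.1 ih.2.2.1 ih.2.2.2

/-- The pairs dominated by some stage of the adjustment sequence of `t`. -/
def adjustmentIdeal (a b c d : M) (t : β × β × β × β) : Set (M × β) :=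
  {p | ∃ n, (a ≤ p.1 → p.2 ≤ (adj4^[n] t).1) ∧ (b ≤ p.1 → p.2 ≤ (adj4^[n] t).2.1) ∧
    (c ≤ p.1 → p.2 ≤ (adj4^[n] t).2.2.1) ∧ (d ≤ p.1 → p.2 ≤ (adj4^[n] t).2.2.2)}

theorem IsM4.isBiIdeal_adjustmentIdeal (h : IsM4 M a b c d) (t : β × β × β × β) :
    IsBiIdeal (adjustmentIdeal a b c d t) := by
  have mono := monotone_iterate_adj4 t
  refine ⟨?_, ?_, ?_, ?_⟩
  · rintro p q ⟨h₁, h₂⟩ ⟨n, ha, hb, hc, hd⟩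
    exact ⟨n, fun k => h₂.trans (ha (k.trans h₁)), fun k => h₂.trans (hb (k.trans h₁)),
      fun k => h₂.trans (hc (k.trans h₁)), fun k => h₂.trans (hd (k.trans h₁))⟩
  · rintro ⟨m, x⟩ (rfl | rfl)
    · unfold IsM4 at h
      exact ⟨0, by simp_all⟩
    · exact ⟨0, by simp⟩
  · rintro m₀ m₁ u ⟨n, ha, hb, hc, hd⟩ ⟨n', ha', hb', hc', hd'⟩
    have hn := mono (le_max_left n n')
    have hn' := mono (le_max_right n n')
    refine ⟨max n n' + 1, ?_⟩
    rw [Function.iterate_succ_apply']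
    dsimp only at hn hn'
    generalize adj4^[max n n'] t = r at hn hn' ⊢
    obtain ⟨x, y, z, w⟩ := r
    have hA : a ≤ m₀ ∨ a ≤ m₁ → u ≤ x := by
      rintro (k | k)
      exacts [(ha k).trans hn.1, (ha' k).trans hn'.1]
    have hB : b ≤ m₀ ∨ b ≤ m₁ → u ≤ y := by
      rintro (k | k)
      exacts [(hb k).trans hn.2.1, (hb' k).trans hn'.2.1]
    have hC : c ≤ m₀ ∨ c ≤ m₁ → u ≤ z := by
      rintro (k | k)
      exacts [(hc k).trans hn.2.2.1, (hc' k).trans hn'.2.2.1]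
    have hD : d ≤ m₀ ∨ d ≤ m₁ → u ≤ w := by
      rintro (k | k)
      exacts [(hd k).trans hn.2.2.2, (hd' k).trans hn'.2.2.2]
    have hcab : IsM4 M c a b d := h.rotate.swap_left.rotate.rotate.rotate.swap_left
    have hdab : IsM4 M d a b c := h.rotate.rotate.rotate
    exact ⟨h.le_adj4_fst hA hB hC hD, h.swap_left.le_adj4_fst hB hA hC hD,
      hcab.le_adj4_fst hC hA hB hD, hdab.le_adj4_fst hD hA hB hC⟩
  · rintro m x₀ x₁ ⟨n, ha, hb, hc, hd⟩ ⟨n', ha', hb', hc', hd'⟩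
    have hn := mono (le_max_left n n')
    have hn' := mono (le_max_right n n')
    exact ⟨max n n', fun k => sup_le ((ha k).trans hn.1) ((ha' k).trans hn'.1),
      fun k => sup_le ((hb k).trans hn.2.1) ((hb' k).trans hn'.2.1),
      fun k => sup_le ((hc k).trans hn.2.2.1) ((hc' k).trans hn'.2.2.1),
      fun k => sup_le ((hd k).trans hn.2.2.2) ((hd' k).trans hn'.2.2.2)⟩

/-- If meets exist in `M₄ ⊗ L`, then every adjustment sequence in `L` is bounded by one of
its stages. -/
theorem IsM4.exists_forall_iterate_adj4_le {L : Type*} [Lattice L] [BoundedOrder L]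
    (h : IsM4 M a b c d)
    (hmeet : ∀ I J : TensorProd M L, ∃ C, IsGLB {I, J} C) (t : L × L × L × L) :
    ∃ n, ∀ k, (adj4^[k] t).1 ≤ (adj4^[n] t).1 := by
  classical
  let I : TensorProd M L :=
    TensorProd.gen {(a, t.1), (b, t.2.1), (c, t.2.2.1), (d, t.2.2.2)}
  let J : TensorProd M L := TensorProd.gen {(a, ⊤)}
  obtain ⟨C, hC⟩ := hmeet I J
  have hmem : ∀ k, (a, (adj4^[k] t).1) ∈ C.1 := by
    intro k
    refine TensorProd.mem_of_isGLB hC ?_ ?_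
    · refine (h.iterate_adj4_mem (isBiIdeal_biIdealClosure _) ?_ ?_ ?_ ?_ k).1 <;>
        exact subset_biIdealClosure _ (by simp)
    · exact (isBiIdeal_biIdealClosure _).1 (show (a, _) ≤ (a, (⊤ : L)) from ⟨le_rfl, le_top⟩)
        (subset_biIdealClosure _ (by simp))
  have hI : I.1 ⊆ adjustmentIdeal a b c d t := by
    refine biIdealClosure_subset (h.isBiIdeal_adjustmentIdeal t) ?_
    have key : ∀ {p q : M}, p ≠ ⊥ → p ⊓ q = ⊥ → ¬ p ≤ q := fun hp hpq hle =>
      hp (by rw [← hpq, inf_eq_left.2 hle])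
    obtain ⟨-, -, -, -, -, -, -, a0, b0, c0, d0, -, -, -, -, -, ab, ac, ad, bc, bd, cd, -⟩ := h
    intro p hp
    refine ⟨0, ?_⟩
    simp only [Finset.coe_insert, Finset.coe_singleton, Set.mem_insert_iff,
      Set.mem_singleton_iff] at hp
    rcases hp with rfl | rfl | rfl | rfl
    · simp [key b0 (inf_comm a b ▸ ab), key c0 (inf_comm a c ▸ ac), key d0 (inf_comm a d ▸ ad)]
    · simp [key a0 ab, key c0 (inf_comm b c ▸ bc), key d0 (inf_comm b d ▸ bd)]
    · simp [key a0 ac, key b0 bc, key d0 (inf_comm c d ▸ cd)]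
    · simp [key a0 ad, key b0 bd, key c0 cd]
  have hJ : J.1 ⊆ pureTensor a ⊤ :=
    biIdealClosure_subset (isBiIdeal_pureTensor _ _) (by simp [pureTensor])
  have hCI : C.1 ⊆ I.1 := hC.1 (by simp)
  have hCJ : C.1 ⊆ J.1 := hC.1 (by simp)
  obtain ⟨s, hs⟩ := C.2
  have hsC : (s : Set (M × L)) ⊆ C.1 := by
    rw [hs]
    exact subset_biIdealClosure _
  have hstage : ∀ p ∈ s, ∃ n, p ∈ pureTensor a (adj4^[n] t).1 := by
    intro p hp
    rcases hJ (hCJ (hsC hp)) with h1 | h1 | ⟨h1, -⟩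
    · exact ⟨0, Or.inl h1⟩
    · exact ⟨0, Or.inr (Or.inl h1)⟩
    · by_cases h0 : p.1 = ⊥
      · exact ⟨0, Or.inl h0⟩
      · obtain ⟨n, hn, -⟩ := hI (hCI (hsC hp))
        exact ⟨n, Or.inr (Or.inr ⟨h1, hn (h.eq_of_le h1 h0).ge⟩)⟩
  choose! N hN using hstage
  refine ⟨s.sup N, fun k => ?_⟩
  have hCP : C.1 ⊆ pureTensor a (adj4^[s.sup N] t).1 := by
    rw [hs]
    refine biIdealClosure_subset (isBiIdeal_pureTensor _ _) fun p hp => ?_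
    rcases hN p hp with h1 | h1 | h1
    · exact Or.inl h1
    · exact Or.inr (Or.inl h1)
    · exact Or.inr (Or.inr ⟨h1.1, h1.2.trans (monotone_iterate_adj4 t (Finset.le_sup hp)).1⟩)
  rcases hCP (hmem k) with h1 | h1 | h1
  · unfold IsM4 at h
    simp_all
  · simp only at h1
    simp [h1]
  · exact h1.2

end MFour

section Subspaces

variable {K U : Type*} [Field K] [AddCommGroup U] [Module K U]

/-- The four subspaces of `U × U` given by the two axes, the diagonal and the graph of `T`,
each enlarged by small subspaces of `U`. -/
def graphQuad (T : U →ₗ[K] U) (N P : Submodule K U) :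
    Submodule K (U × U) × Submodule K (U × U) × Submodule K (U × U) × Submodule K (U × U) :=
  (N.comap (LinearMap.snd K U U), P.comap (LinearMap.fst K U U),
    P.comap (LinearMap.fst K U U - LinearMap.snd K U U),
    N.comap (LinearMap.snd K U U - T ∘ₗ LinearMap.fst K U U))

variable {T : U →ₗ[K] U} {N : Submodule K U}

theorem adj4_graphQuad_self (hT : N ≤ N.comap T) (h1 : ∀ u, u - T u ∈ N → u ∈ N) :
    adj4 (graphQuad T N N) = graphQuad T N (N.comap T) := by
  have hT' : ∀ u ∈ N, T u ∈ N := hT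
  have hTsub : ∀ x y, x - y ∈ N → T x - T y ∈ N := fun x y h => map_sub T x y ▸ hT h
  have hsub : ∀ x y, x ∈ N → y ∈ N → x - y ∈ N := fun _ _ => N.sub_mem
  have hleft : ∀ x y, y ∈ N → x - y ∈ N → x ∈ N := fun _ _ hy => (N.sub_mem_iff_left hy).1
  have hright : ∀ x y, x ∈ N → x - y ∈ N → y ∈ N := fun _ _ hx => (N.sub_mem_iff_right hx).1
  have htrans : ∀ x y z, x - y ∈ N → y - z ∈ N → x - z ∈ N := fun x y z h h' => by
    simpa using N.add_mem h h'
  simp only [graphQuad, adj4, Prod.mk.injEq]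
  refine ⟨le_antisymm (sup_le (sup_le (sup_le le_rfl ?_) ?_) ?_)
      (le_sup_of_le_left (le_sup_of_le_left le_sup_left)),
    le_antisymm (sup_le (sup_le (sup_le ?_ ?_) ?_) ?_)
      (le_sup_of_le_left (le_trans ?_ (sup_le_sup_right le_sup_left _))),
    le_antisymm (sup_le (sup_le (sup_le ?_ ?_) ?_) ?_)
      (le_sup_of_le_left (le_trans ?_ (sup_le_sup_right le_sup_left _))),
    le_antisymm (sup_le (sup_le (sup_le le_rfl ?_) ?_) ?_)
      (le_sup_of_le_left (le_sup_of_le_left le_sup_left))⟩ <;>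
  rintro ⟨u, v⟩ h <;>
  simp only [Submodule.mem_inf, Submodule.mem_comap, LinearMap.fst_apply, LinearMap.snd_apply,
    LinearMap.sub_apply, LinearMap.comp_apply, map_sub] at h ⊢
  case refine_8 =>
    exact Submodule.mem_sup.2 ⟨(0, v), by simp, (u, 0), by simpa using h, by simp⟩
  case refine_13 =>
    exact Submodule.mem_sup.2 ⟨(v, v), by simp, (u - v, 0), by simpa using sub_mem_comm_iff.1 h, by simp⟩
  all_goals grind

theorem adj4_graphQuad_comap (hT : N ≤ N.comap T) (h1 : ∀ u, u - T u ∈ N → u ∈ N) :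
    adj4 (graphQuad T N (N.comap T)) = graphQuad T (N.comap T) (N.comap T) := by
  have hT' : ∀ u ∈ N, T u ∈ N := hT
  have hTsub : ∀ x y, x - y ∈ N → T x - T y ∈ N := fun x y h => map_sub T x y ▸ hT h
  have hsub : ∀ x y, x ∈ N → y ∈ N → x - y ∈ N := fun _ _ => N.sub_mem
  have hleft : ∀ x y, y ∈ N → x - y ∈ N → x ∈ N := fun _ _ hy => (N.sub_mem_iff_left hy).1
  have hright : ∀ x y, x ∈ N → x - y ∈ N → y ∈ N := fun _ _ hx => (N.sub_mem_iff_right hx).1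
  have htrans : ∀ x y z, x - y ∈ N → y - z ∈ N → x - z ∈ N := fun x y z h h' => by
    simpa using N.add_mem h h'
  simp only [graphQuad, adj4, Prod.mk.injEq]
  refine ⟨le_antisymm (sup_le (sup_le (sup_le ?_ ?_) ?_) ?_)
      (le_sup_of_le_left (le_sup_of_le_left ?_)),
    le_antisymm (sup_le (sup_le (sup_le le_rfl ?_) ?_) ?_)
      (le_sup_of_le_left (le_sup_of_le_left le_sup_left)),
    le_antisymm (sup_le (sup_le (sup_le le_rfl ?_) ?_) ?_)
      (le_sup_of_le_left (le_sup_of_le_left le_sup_left)),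
    le_antisymm (sup_le (sup_le (sup_le ?_ ?_) ?_) ?_)
      (le_trans ?_ (sup_le_sup_right (le_sup_of_le_left le_sup_left) _))⟩ <;>
  rintro ⟨u, v⟩ h <;>
  simp only [Submodule.mem_inf, Submodule.mem_comap, LinearMap.fst_apply, LinearMap.snd_apply,
    LinearMap.sub_apply, LinearMap.comp_apply, map_sub] at h ⊢
  case refine_5 =>
    exact Submodule.mem_sup.2 ⟨(u, 0), by simp, (0, v), by simpa using h, by simp⟩
  case refine_16 =>
    exact Submodule.mem_sup.2 ⟨(u, T u), by simp, (0, v - T u), by simpa using sub_mem_comm_iff.1 h, by simp⟩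
  all_goals grind

end Subspaces

section Shift

open Polynomial

variable (K : Type*) [Field K]

/-- The backward shift on polynomials, as a linear map. -/
noncomputable def shift : K[X] →ₗ[K] K[X] where
  toFun := divX
  map_add' _ _ := divX_add
  map_smul' r p := by simp [smul_eq_C_mul, divX_C_mul]

/-- The kernel of the `n`-th power of the backward shift. -/
noncomputable def shiftKer : ℕ → Submodule K K[X]
  | 0 => ⊥
  | n + 1 => (shiftKer n).comap (shift K)

theorem shiftKer_le_succ (n : ℕ) : shiftKer K n ≤ shiftKer K (n + 1) := by
  induction n with
  | zero => exact bot_le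
  | succ n ih => exact Submodule.comap_mono ih

theorem mem_shiftKer_of_sub_shift_mem {n : ℕ} {p : K[X]} (h : p - shift K p ∈ shiftKer K n) :
    p ∈ shiftKer K n := by
  induction n generalizing p with
  | zero =>
    by_contra hp
    have h' : p = divX p := sub_eq_zero.1 h
    exact (degree_divX_lt hp).ne (congrArg degree h'.symm)
  | succ n ih =>
    refine ih ?_
    rw [← map_sub]
    exact h

theorem X_pow_mem_shiftKer_iff {m n : ℕ} : (X ^ m : K[X]) ∈ shiftKer K n ↔ m < n := by
  induction n generalizing m with
  | zero => simp [shiftKer]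
  | succ n ih =>
    change divX (X ^ m) ∈ shiftKer K n ↔ _
    cases m with
    | zero => simp [divX_one]
    | succ m => simp [divX_X_pow, ih]

theorem iterate_adj4_graphQuad_shift (n : ℕ) :
    adj4^[2 * n] (graphQuad (shift K) ⊥ ⊥) =
      graphQuad (shift K) (shiftKer K n) (shiftKer K n) := by
  induction n with
  | zero => rfl
  | succ n ih =>
    have hT := shiftKer_le_succ K n
    have h1 := fun p => mem_shiftKer_of_sub_shift_mem K (n := n) (p := p)
    rw [mul_add, mul_one, Function.iterate_succ_apply', Function.iterate_succ_apply', ih,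
      adj4_graphQuad_self hT h1, adj4_graphQuad_comap hT h1]
    rfl

theorem iterate_adj4_graphQuad_shift_unbounded (n : ℕ) :
    ∃ k, ¬ (adj4^[k] (graphQuad (shift K) ⊥ ⊥)).1 ≤ (adj4^[n] (graphQuad (shift K) ⊥ ⊥)).1 := by
  refine ⟨2 * (n + 1), fun h => ?_⟩
  have hle := h.trans (monotone_iterate_adj4 _ (show n ≤ 2 * n by lia)).1
  simp only [iterate_adj4_graphQuad_shift] at hle
  have hX : ((0, X ^ n) : K[X] × K[X]) ∈
      (graphQuad (shift K) (shiftKer K (n + 1)) (shiftKer K (n + 1))).1 :=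
    (X_pow_mem_shiftKer_iff K).2 n.lt_succ_self
  exact lt_irrefl n ((X_pow_mem_shiftKer_iff K).1 (hle hX))

variable {K}

theorem exists_injective_polynomial_prod {V : Type*} [AddCommGroup V] [Module K V]
    (hV : ¬ FiniteDimensional K V) :
    ∃ f : K[X] × K[X] →ₗ[K] V, Function.Injective f := by
  let e := Module.Basis.ofVectorSpace K V
  have : Infinite (Module.Basis.ofVectorSpaceIndex K V) := by
    by_contra hfin
    rw [not_infinite_iff_finite] at hfin
    exact hV (Module.Finite.of_basis e)
  let g : ℕ ⊕ ℕ ↪ Module.Basis.ofVectorSpaceIndex K V :=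
    Equiv.natSumNatEquivNat.toEmbedding.trans (Infinite.natEmbedding _)
  let p := (basisMonomials K).prod (basisMonomials K)
  exact ⟨p.constr K (e ∘ g), p.injective_constr_of_linearIndependent
    (e.linearIndependent.comp g g.injective)⟩

theorem exists_unbounded_iterate_adj4 {V : Type*} [AddCommGroup V] [Module K V]
    (hV : ¬ FiniteDimensional K V) :
    ∃ t : Submodule K V × Submodule K V × Submodule K V × Submodule K V,
      ∀ n, ∃ k, ¬ (adj4^[k] t).1 ≤ (adj4^[n] t).1 := by
  obtain ⟨f, hf⟩ := exists_injective_polynomial_prod hV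
  refine ⟨mapQuad (Submodule.map f) (graphQuad (shift K) ⊥ ⊥), fun n => ?_⟩
  have hsemi : Function.Semiconj (mapQuad (Submodule.map f)) adj4 adj4 := fun t =>
    (adj4_mapQuad (fun x y => Submodule.map_sup x y f)
      (fun x y => Submodule.map_inf f hf) t).symm
  obtain ⟨k, hk⟩ := iterate_adj4_graphQuad_shift_unbounded K n
  refine ⟨k, fun h => hk ?_⟩
  rw [← (hsemi.iterate_right k).eq, ← (hsemi.iterate_right n).eq] at h
  exact (Submodule.map_le_map_iff_of_injective hf _ _).1 h

end Shift

/-- Let `V` be an infinite-dimensional vector space over a field `K` and `L(V)` its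
subspace lattice.  Then `M₄ ⊗ L(V)` is not a lattice; in particular some quadruple of
subspaces has an adjustment sequence that never stabilizes. -/
theorem stmt16 {K V : Type*} [Field K] [AddCommGroup V] [Module K V]
    (hV : ¬ FiniteDimensional K V)
    {M : Type*} [Lattice M] [BoundedOrder M] {a b c d : M} (hM : IsM4 M a b c d) :
    ¬ ((∀ I J : TensorProd M (Submodule K V), ∃ C, IsLUB {I, J} C) ∧
       (∀ I J : TensorProd M (Submodule K V), ∃ C, IsGLB {I, J} C)) ∧
    ∃ t : Submodule K V × Submodule K V × Submodule K V × Submodule K V,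
      ∀ n : ℕ, adj4^[n] t ≠ adj4^[n + 1] t := by
  obtain ⟨t, ht⟩ := exists_unbounded_iterate_adj4 hV
  refine ⟨fun h => ?_, t, iterate_adj4_ne_of_unbounded ht⟩
  obtain ⟨n, hn⟩ := hM.exists_forall_iterate_adj4_le h.2 t
  obtain ⟨k, hk⟩ := ht n
  exact hk (hn k)
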